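/- Consider on the region D = {(t,x,y,z) ∈ ℝ⁴ : 0 < t < π/2} the conformally flat Bianchi I metric g = diag(−1, sin²t, cos²t, 1). For each ε ∈ {−1, +1}: (i) the vector field C¹ with components e^{ε y}(sin t sin z, 0, ε sin z / cos t, −cos t cos z) is a conformal Killing vector of g with conformal factor ψ¹ = e^{ε y} cos t sin z, and (ii) the vector field C² with components e^{ε y}(sin t cos z, 0, ε cos z / cos t, cos t sin z) is a conformal Killing vector of g with conformal factor ψ² = e^{ε y} cos t cos z. -/

import Mathlib

open Real

/-- Directional (partial) derivative along coordinate `k` on ℝ⁴. -/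
noncomputable def pd (k : Fin 4) (f : (Fin 4 → ℝ) → ℝ) (p : Fin 4 → ℝ) : ℝ :=
  fderiv ℝ f p (Pi.single k 1)

/-- Components of the conformally flat Bianchi I metric `diag(−1, sin²t, cos²t, 1)`. -/
noncomputable def gmet (p : Fin 4 → ℝ) (i j : Fin 4) : ℝ :=
  if i = j then
    (![(-1 : ℝ), (Real.sin (p 0)) ^ 2, (Real.cos (p 0)) ^ 2, 1] : Fin 4 → ℝ) i
  else 0

/-- `C¹ = e^{εy}(sin t sin z ∂_t + ε (sin z / cos t) ∂_y − cos t cos z ∂_z)`. -/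
noncomputable def C1 (ε : ℝ) (q : Fin 4 → ℝ) : Fin 4 → ℝ :=
  fun k => Real.exp (ε * q 2) *
    (![Real.sin (q 0) * Real.sin (q 3), 0, ε * Real.sin (q 3) / Real.cos (q 0),
        -(Real.cos (q 0) * Real.cos (q 3))] : Fin 4 → ℝ) k

/-- `C² = e^{εy}(sin t cos z ∂_t + ε (cos z / cos t) ∂_y + cos t sin z ∂_z)`. -/
noncomputable def C2 (ε : ℝ) (q : Fin 4 → ℝ) : Fin 4 → ℝ :=
  fun k => Real.exp (ε * q 2) *
    (![Real.sin (q 0) * Real.cos (q 3), 0, ε * Real.cos (q 3) / Real.cos (q 0),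
        Real.cos (q 0) * Real.sin (q 3)] : Fin 4 → ℝ) k

lemma pd_sep (ε : ℝ) (F H : ℝ → ℝ) (F' H' : ℝ) (p : Fin 4 → ℝ) (k : Fin 4)
    (hF : HasDerivAt F F' (p 0)) (hH : HasDerivAt H H' (p 3)) :
    pd k (fun q => Real.exp (ε * q 2) * (F (q 0) * H (q 3))) p =
      (![Real.exp (ε * p 2) * (F' * H (p 3)), 0, ε * Real.exp (ε * p 2) * (F (p 0) * H (p 3)),
        Real.exp (ε * p 2) * (F (p 0) * H')] : Fin 4 → ℝ) k := by
  have h (i : Fin 4) : HasFDerivAt (fun q : Fin 4 → ℝ => q i)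
      (ContinuousLinearMap.proj (R := ℝ) (φ := fun _ : Fin 4 => ℝ) i) p := hasFDerivAt_apply i p
  have h0 := hF.comp_hasFDerivAt p (h 0)
  have h3 := hH.comp_hasFDerivAt p (h 3)
  have h2 := ((h 2).const_mul ε).exp
  have := h2.mul (h0.mul h3)
  have e := this.fderiv
  unfold pd
  have e2 : fderiv ℝ (fun q : Fin 4 → ℝ => Real.exp (ε * q 2) * (F (q 0) * H (q 3))) p = _ := e
  rw [e2]
  fin_cases k <;> simp <;> ring

lemma pd_const (k : Fin 4) (c : ℝ) (p : Fin 4 → ℝ) : pd k (fun _ => c) p = 0 := by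
  simp [pd]

lemma pd_gmet (k i j : Fin 4) (p : Fin 4 → ℝ) : pd k (fun q => gmet q i j) p =
    if i = j ∧ k = 0 then (![0, 2 * Real.sin (p 0) * Real.cos (p 0),
      -(2 * Real.sin (p 0) * Real.cos (p 0)), 0] : Fin 4 → ℝ) i else 0 := by
  by_cases hij : i = j
  · subst hij
    have a := pd_sep 0 (fun t => Real.sin t ^ 2) (fun _ => 1) _ _ p k
      ((Real.hasDerivAt_sin (p 0)).pow 2) (hasDerivAt_const _ _)
    have b := pd_sep 0 (fun t => Real.cos t ^ 2) (fun _ => 1) _ _ p k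
      ((Real.hasDerivAt_cos (p 0)).pow 2) (hasDerivAt_const _ _)
    simp at a b
    fin_cases i
    · simp [gmet, pd_const]
    · simp [gmet, a]
      fin_cases k <;> simp
    · simp [gmet, b]
      fin_cases k <;> simp
      ring
    · simp [gmet, pd_const]
  · simp [gmet, hij, pd_const]

lemma hasDerivAt_inv_cos (ε t : ℝ) (h : Real.cos t ≠ 0) :
    HasDerivAt (fun t => ε / Real.cos t) (ε * Real.sin t / Real.cos t ^ 2) t := by
  have := (hasDerivAt_const t ε).div (Real.hasDerivAt_cos t) h
  have e : (0 * Real.cos t - ε * -Real.sin t) / Real.cos t ^ 2 = ε * Real.sin t / Real.cos t ^ 2 := by ring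
  rw [e] at this
  exact this

lemma pd_C1 (ε : ℝ) (p : Fin 4 → ℝ) (h : Real.cos (p 0) ≠ 0) (k : Fin 4) :
    pd k (fun q => C1 ε q 0) p = (![Real.exp (ε * p 2) * (Real.cos (p 0) * Real.sin (p 3)), 0,
      ε * Real.exp (ε * p 2) * (Real.sin (p 0) * Real.sin (p 3)),
      Real.exp (ε * p 2) * (Real.sin (p 0) * Real.cos (p 3))] : Fin 4 → ℝ) k ∧
    pd k (fun q => C1 ε q 1) p = 0 ∧
    pd k (fun q => C1 ε q 2) p =
      (![Real.exp (ε * p 2) * (ε * Real.sin (p 0) / Real.cos (p 0) ^ 2 * Real.sin (p 3)), 0,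
      ε * Real.exp (ε * p 2) * (ε / Real.cos (p 0) * Real.sin (p 3)),
      Real.exp (ε * p 2) * (ε / Real.cos (p 0) * Real.cos (p 3))] : Fin 4 → ℝ) k ∧
    pd k (fun q => C1 ε q 3) p = (![Real.exp (ε * p 2) * (- -Real.sin (p 0) * Real.cos (p 3)), 0,
      ε * Real.exp (ε * p 2) * (-Real.cos (p 0) * Real.cos (p 3)),
      Real.exp (ε * p 2) * (-Real.cos (p 0) * (-Real.sin (p 3)))] : Fin 4 → ℝ) k := by
  refine ⟨?_, ?_, ?_, ?_⟩
  · exact pd_sep ε Real.sin Real.sin _ _ p k (Real.hasDerivAt_sin _) (Real.hasDerivAt_sin _)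
  · simp [C1, pd_const]
  · rw [← pd_sep ε (fun t => ε / Real.cos t) Real.sin _ _ p k (hasDerivAt_inv_cos ε _ h)
      (Real.hasDerivAt_sin _)]
    congr 1
    funext q
    simp [C1]
    try ring
  · rw [← pd_sep ε (fun t => -Real.cos t) Real.cos _ _ p k (Real.hasDerivAt_cos _).neg
      (Real.hasDerivAt_cos _)]
    congr 1
    funext q
    simp [C1]

lemma pd_C2 (ε : ℝ) (p : Fin 4 → ℝ) (h : Real.cos (p 0) ≠ 0) (k : Fin 4) :
    pd k (fun q => C2 ε q 0) p = (![Real.exp (ε * p 2) * (Real.cos (p 0) * Real.cos (p 3)), 0,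
      ε * Real.exp (ε * p 2) * (Real.sin (p 0) * Real.cos (p 3)),
      Real.exp (ε * p 2) * (Real.sin (p 0) * (-Real.sin (p 3)))] : Fin 4 → ℝ) k ∧
    pd k (fun q => C2 ε q 1) p = 0 ∧
    pd k (fun q => C2 ε q 2) p =
      (![Real.exp (ε * p 2) * (ε * Real.sin (p 0) / Real.cos (p 0) ^ 2 * Real.cos (p 3)), 0,
      ε * Real.exp (ε * p 2) * (ε / Real.cos (p 0) * Real.cos (p 3)),
      Real.exp (ε * p 2) * (ε / Real.cos (p 0) * (-Real.sin (p 3)))] : Fin 4 → ℝ) k ∧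
    pd k (fun q => C2 ε q 3) p = (![Real.exp (ε * p 2) * (-Real.sin (p 0) * Real.sin (p 3)), 0,
      ε * Real.exp (ε * p 2) * (Real.cos (p 0) * Real.sin (p 3)),
      Real.exp (ε * p 2) * (Real.cos (p 0) * Real.cos (p 3))] : Fin 4 → ℝ) k := by
  refine ⟨?_, ?_, ?_, ?_⟩
  · exact pd_sep ε Real.sin Real.cos _ _ p k (Real.hasDerivAt_sin _) (Real.hasDerivAt_cos _)
  · simp [C2, pd_const]
  · rw [← pd_sep ε (fun t => ε / Real.cos t) Real.cos _ _ p k (hasDerivAt_inv_cos ε _ h)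
      (Real.hasDerivAt_cos _)]
    congr 1
    funext q
    simp [C2]
    try ring
  · rw [← pd_sep ε (fun t => Real.cos t) Real.sin _ _ p k (Real.hasDerivAt_cos _)
      (Real.hasDerivAt_sin _)]
    congr 1

/-- for each `ε ∈ {−1,+1}`, `C¹` is a CKV of `diag(−1, sin²t, cos²t, 1)` on
`0 < t < π/2` with conformal factor `ψ¹ = e^{εy} cos t sin z`, and `C²` is a CKV with
conformal factor `ψ² = e^{εy} cos t cos z`. -/
theorem stmt6 (ε : ℝ) (hε : ε = -1 ∨ ε = 1) :
    (∀ (i j : Fin 4) (p : Fin 4 → ℝ), p 0 ∈ Set.Ioo 0 (π / 2) →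
      (∑ k : Fin 4,
        (C1 ε p k * pd k (fun q => gmet q i j) p
          + gmet p k j * pd i (fun q => C1 ε q k) p
          + gmet p i k * pd j (fun q => C1 ε q k) p))
      = 2 * (Real.exp (ε * p 2) * Real.cos (p 0) * Real.sin (p 3)) * gmet p i j)
    ∧
    (∀ (i j : Fin 4) (p : Fin 4 → ℝ), p 0 ∈ Set.Ioo 0 (π / 2) →
      (∑ k : Fin 4,
        (C2 ε p k * pd k (fun q => gmet q i j) p
          + gmet p k j * pd i (fun q => C2 ε q k) p
          + gmet p i k * pd j (fun q => C2 ε q k) p))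
      = 2 * (Real.exp (ε * p 2) * Real.cos (p 0) * Real.cos (p 3)) * gmet p i j) := by
  have h2 : ε ^ 2 = 1 := by rcases hε with rfl | rfl <;> norm_num
  constructor
  · intro i j p hp
    have hc : Real.cos (p 0) ≠ 0 :=
      (Real.cos_pos_of_mem_Ioo ⟨by linarith [hp.1, Real.pi_pos], hp.2⟩).ne'
    have hs := Real.sin_sq_add_cos_sq (p 0)
    have e0 := fun k => (pd_C1 ε p hc k).1
    have e1 := fun k => (pd_C1 ε p hc k).2.1
    have e2 := fun k => (pd_C1 ε p hc k).2.2.1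
    have e3 := fun k => (pd_C1 ε p hc k).2.2.2
    simp only [Fin.sum_univ_four, pd_gmet, e0, e1, e2, e3]
    clear e0 e1 e2 e3
    fin_cases i <;> fin_cases j <;> simp [gmet, C1] <;> field_simp <;>
      first
      | done
      | ring1
      | (ring_nf; linear_combination (2 * Real.sin (p 3)) * (h2 - hs))
  · intro i j p hp
    have hc : Real.cos (p 0) ≠ 0 :=
      (Real.cos_pos_of_mem_Ioo ⟨by linarith [hp.1, Real.pi_pos], hp.2⟩).ne'
    have hs := Real.sin_sq_add_cos_sq (p 0)
    have e0 := fun k => (pd_C2 ε p hc k).1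
    have e1 := fun k => (pd_C2 ε p hc k).2.1
    have e2 := fun k => (pd_C2 ε p hc k).2.2.1
    have e3 := fun k => (pd_C2 ε p hc k).2.2.2
    simp only [Fin.sum_univ_four, pd_gmet, e0, e1, e2, e3]
    clear e0 e1 e2 e3
    fin_cases i <;> fin_cases j <;> simp [gmet, C2] <;> field_simp <;>
      first
      | done
      | ring1
      | (ring_nf; linear_combination (2 * Real.cos (p 3)) * (h2 - hs))
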